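/- arXiv:2207.04069 — 6 statements merged into one kernel-verified Lean document; each statement's English description precedes it below -/
import Mathlib

section
/- Under the stated hypotheses, the family Λ^n := W^n ∘ G^n : V^n → V^{n−1} is a contracting homotopy for (V, d): d^{n−1} ∘ W^n ∘ G^n + W^{n+1} ∘ G^{n+1} ∘ d^n = id_{V^n} for every n ∈ ℤ. -/
/-- Setup as in Statement 0 (components written at shifted degree: `W n` is the
component `W^{n+1} : V^{n+1} → V^n` and `G n` the two-sided inverse `G^{n+1}` of
`P^{n+1} = (d n).comp (W n) + (W (n+1)).comp (d (n+1))`).  Then `Λ^n := W^n ∘ G^n` is a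
contracting homotopy: `d^{n-1} ∘ W^n ∘ G^n + W^{n+1} ∘ G^{n+1} ∘ d^n = id` in every degree;
written at degree `n+1` this reads
`(d n).comp ((W n).comp (G n)) + (W (n+1)).comp ((G (n+1)).comp (d (n+1))) = id`. -/
theorem stmt1 {K : Type*} [Field K] (V : ℤ → Type*)
    [∀ n, AddCommGroup (V n)] [∀ n, Module K (V n)]
    (d : ∀ n : ℤ, V n →ₗ[K] V (n + 1))
    (hd : ∀ (n : ℤ) (x : V n), d (n + 1) (d n x) = 0)
    (W : ∀ n : ℤ, V (n + 1) →ₗ[K] V n)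
    (G : ∀ n : ℤ, V (n + 1) →ₗ[K] V (n + 1))
    (hGP : ∀ n : ℤ,
      (G n).comp ((d n).comp (W n) + (W (n + 1)).comp (d (n + 1))) = LinearMap.id)
    (hPG : ∀ n : ℤ,
      ((d n).comp (W n) + (W (n + 1)).comp (d (n + 1))).comp (G n) = LinearMap.id) :
    ∀ n : ℤ,
      (d n).comp ((W n).comp (G n)) + (W (n + 1)).comp ((G (n + 1)).comp (d (n + 1)))
        = LinearMap.id := by
  intro n
  ext y
  have hP : ∀ x : V (n + 1), d n (W n (G n x)) + W (n + 1) (d (n + 1) (G n x)) = x :=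
    fun x => LinearMap.congr_fun (hPG n) x
  have hdy : d (n + 1) (W (n + 1) (d (n + 1) (G n y))) = d (n + 1) y := by
    simpa [hd] using congrArg (d (n + 1)) (hP y)
  have hcomm : G (n + 1) (d (n + 1) y) = d (n + 1) (G n y) := by
    simpa [hd, hdy] using LinearMap.congr_fun (hGP (n + 1)) (d (n + 1) (G n y))
  simpa [hcomm] using hP y
end

section
/- Under the stated hypotheses, the cochain complex (V, d) is exact in every degree: ker(d^n) = im(d^{n−1}) for every n ∈ ℤ. -/
/-- Setup as in Statement 0 (components written at shifted degree: `W n` is the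
component `W^{n+1} : V^{n+1} → V^n` and `G n` the two-sided inverse `G^{n+1}` of
`P^{n+1} = (d n).comp (W n) + (W (n+1)).comp (d (n+1))`).  Then the cochain complex `(V, d)`
is exact in every degree: `ker (d^n) = im (d^{n-1})`; written at degree `n+1` this reads
`ker (d (n+1)) = range (d n)` for every `n : ℤ`. -/
theorem stmt2 {K : Type*} [Field K] (V : ℤ → Type*)
    [∀ n, AddCommGroup (V n)] [∀ n, Module K (V n)]
    (d : ∀ n : ℤ, V n →ₗ[K] V (n + 1))
    (hd : ∀ (n : ℤ) (x : V n), d (n + 1) (d n x) = 0)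
    (W : ∀ n : ℤ, V (n + 1) →ₗ[K] V n)
    (G : ∀ n : ℤ, V (n + 1) →ₗ[K] V (n + 1))
    (hGP : ∀ n : ℤ,
      (G n).comp ((d n).comp (W n) + (W (n + 1)).comp (d (n + 1))) = LinearMap.id)
    (hPG : ∀ n : ℤ,
      ((d n).comp (W n) + (W (n + 1)).comp (d (n + 1))).comp (G n) = LinearMap.id) :
    ∀ n : ℤ, LinearMap.ker (d (n + 1)) = LinearMap.range (d n) := by
  intro n
  refine le_antisymm (fun x hx => ?_) ?_
  · have hx0 : d (n + 1) x = 0 := hx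
    have hPy : d n (W n (G n x)) + W (n + 1) (d (n + 1) (G n x)) = x :=
      LinearMap.congr_fun (hPG n) x
    have hdWd : d (n + 1) (W (n + 1) (d (n + 1) (G n x))) = 0 := by
      have h := congrArg (d (n + 1)) hPy
      rwa [map_add, hd, zero_add, hx0] at h
    have hdy : d (n + 1) (G n x) = 0 := by
      have h := LinearMap.congr_fun (hGP (n + 1)) (d (n + 1) (G n x))
      simpa [hd, hdWd] using h.symm
    exact ⟨W n (G n x), by simpa [hdy] using hPy⟩
  · rintro _ ⟨y, rfl⟩
    exact hd n y
end

section
/- Under the stated hypotheses, the family Λ̃^n := G^{n−1} ∘ W^n : V^n → V^{n−1} is also a contracting homotopy for (V, d): d^{n−1} ∘ G^{n−1} ∘ W^n + G^n ∘ W^{n+1} ∘ d^n = id_{V^n} for every n ∈ ℤ. -/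
/-- Setup as in Statement 0 (components written at shifted degree: `W n` is the
component `W^{n+1} : V^{n+1} → V^n` and `G n` the two-sided inverse `G^{n+1}` of
`P^{n+1} = (d n).comp (W n) + (W (n+1)).comp (d (n+1))`).  Then `Λ̃^n := G^{n-1} ∘ W^n` is
also a contracting homotopy: `d^{n-1} ∘ G^{n-1} ∘ W^n + G^n ∘ W^{n+1} ∘ d^n = id` in every
degree; written at degree `n+2` this reads
`(d (n+1)).comp ((G n).comp (W (n+1))) + (G (n+1)).comp ((W (n+1+1)).comp (d (n+1+1))) = id`. -/
theorem stmt3 {K : Type*} [Field K] (V : ℤ → Type*)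
    [∀ n, AddCommGroup (V n)] [∀ n, Module K (V n)]
    (d : ∀ n : ℤ, V n →ₗ[K] V (n + 1))
    (hd : ∀ (n : ℤ) (x : V n), d (n + 1) (d n x) = 0)
    (W : ∀ n : ℤ, V (n + 1) →ₗ[K] V n)
    (G : ∀ n : ℤ, V (n + 1) →ₗ[K] V (n + 1))
    (hGP : ∀ n : ℤ,
      (G n).comp ((d n).comp (W n) + (W (n + 1)).comp (d (n + 1))) = LinearMap.id)
    (hPG : ∀ n : ℤ,
      ((d n).comp (W n) + (W (n + 1)).comp (d (n + 1))).comp (G n) = LinearMap.id) :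
    ∀ n : ℤ,
      (d (n + 1)).comp ((G n).comp (W (n + 1)))
        + (G (n + 1)).comp ((W (n + 1 + 1)).comp (d (n + 1 + 1)))
        = LinearMap.id := by
  intro n
  have hcomm (y : V (n + 1)) : d (n + 1) (G n y) = G (n + 1) (d (n + 1) y) := by
    have hy := LinearMap.congr_fun (hPG n) y
    have hz := LinearMap.congr_fun (hGP (n + 1)) (d (n + 1) (G n y))
    simp only [LinearMap.comp_apply, LinearMap.add_apply, LinearMap.id_apply] at hy hz
    rw [hd, map_zero, add_zero] at hz
    rw [← hz]
    conv_rhs => rw [← hy]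
    rw [map_add (d (n + 1)), hd, zero_add]
  ext x
  have hx := LinearMap.congr_fun (hGP (n + 1)) x
  simp only [LinearMap.comp_apply, LinearMap.add_apply, LinearMap.id_apply, map_add] at hx ⊢
  rw [hcomm, hx]
end

section
/- Under the stated hypotheses, the family of degree −2 maps λ^n := W^{n−1} ∘ G^{n−1} ∘ G^{n−1} ∘ W^n : V^n → V^{n−2} is a homotopy between the two contracting homotopies W∘G and G∘W: d^{n−2} ∘ λ^n − λ^{n+1} ∘ d^n = G^{n−1} ∘ W^n − W^n ∘ G^n for every n ∈ ℤ. -/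
/-- A two-sided inverse `G` of `P = d W + W d` commutes with the differential. -/
theorem differential_comp_inverse {K : Type*} [Field K] {V : ℤ → Type*}
    [∀ n, AddCommGroup (V n)] [∀ n, Module K (V n)]
    {d : ∀ n : ℤ, V n →ₗ[K] V (n + 1)}
    (hd : ∀ (n : ℤ) (x : V n), d (n + 1) (d n x) = 0)
    {W : ∀ n : ℤ, V (n + 1) →ₗ[K] V n}
    {G : ∀ n : ℤ, V (n + 1) →ₗ[K] V (n + 1)}
    (hGP : ∀ n x, G n (d n (W n x) + W (n + 1) (d (n + 1) x)) = x)
    (hPG : ∀ n x, d n (W n (G n x)) + W (n + 1) (d (n + 1) (G n x)) = x)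
    (n : ℤ) (x : V (n + 1)) :
    d (n + 1) (G n x) = G (n + 1) (d (n + 1) x) := by
  have h := hGP (n + 1) (d (n + 1) (G n x))
  have h' := congrArg (d (n + 1)) (hPG n x)
  rw [map_add, hd, zero_add] at h'
  rw [hd, map_zero, add_zero, h'] at h
  exact h.symm

/-- Setup as in Statement 0 (components written at shifted degree: `W n` is the
component `W^{n+1} : V^{n+1} → V^n` and `G n` the two-sided inverse `G^{n+1}` of
`P^{n+1} = (d n).comp (W n) + (W (n+1)).comp (d (n+1))`).  The degree `-2` maps
`λ^n := W^{n-1} ∘ G^{n-1} ∘ G^{n-1} ∘ W^n` give a homotopy between the two contracting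
homotopies `W ∘ G` and `G ∘ W`:
`d^{n-2} ∘ λ^n − λ^{n+1} ∘ d^n = G^{n-1} ∘ W^n − W^n ∘ G^n` in every degree; written at
degree `n+2` this is the identity below. -/
theorem stmt4 {K : Type*} [Field K] (V : ℤ → Type*)
    [∀ n, AddCommGroup (V n)] [∀ n, Module K (V n)]
    (d : ∀ n : ℤ, V n →ₗ[K] V (n + 1))
    (hd : ∀ (n : ℤ) (x : V n), d (n + 1) (d n x) = 0)
    (W : ∀ n : ℤ, V (n + 1) →ₗ[K] V n)
    (G : ∀ n : ℤ, V (n + 1) →ₗ[K] V (n + 1))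
    (hGP : ∀ n : ℤ,
      (G n).comp ((d n).comp (W n) + (W (n + 1)).comp (d (n + 1))) = LinearMap.id)
    (hPG : ∀ n : ℤ,
      ((d n).comp (W n) + (W (n + 1)).comp (d (n + 1))).comp (G n) = LinearMap.id) :
    ∀ n : ℤ,
      (d n).comp ((W n).comp ((G n).comp ((G n).comp (W (n + 1)))))
        - ((W (n + 1)).comp ((G (n + 1)).comp ((G (n + 1)).comp (W (n + 1 + 1))))).comp
            (d (n + 1 + 1))
        = (G n).comp (W (n + 1)) - (W (n + 1)).comp (G (n + 1)) := by
  have hGP' : ∀ n x, G n (d n (W n x) + W (n + 1) (d (n + 1) x)) = x :=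
    fun n x => LinearMap.congr_fun (hGP n) x
  have hPG' : ∀ n x, d n (W n (G n x)) + W (n + 1) (d (n + 1) (G n x)) = x :=
    fun n x => LinearMap.congr_fun (hPG n) x
  have hdG := differential_comp_inverse hd hGP' hPG'
  intro n
  ext x
  simp only [LinearMap.sub_apply, LinearMap.comp_apply]
  have h₁ := hPG' n (G n (W (n + 1) x))
  rw [hdG, hdG] at h₁
  have h₂ := congrArg (fun y => W (n + 1) (G (n + 1) y)) (hGP' (n + 1) x)
  simp only [map_add] at h₂
  rw [eq_sub_of_add_eq h₁, ← h₂]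
  abel
end

section
/- Under the stated hypotheses, assume in addition that d^{n−2} ∘ W^{n−1} ∘ W^n = W^n ∘ W^{n+1} ∘ d^n for every n ∈ ℤ (condition (i) in the definition of a formally self-adjoint Green's witness). Then W commutes with P, i.e. P^{n−1} ∘ W^n = W^n ∘ P^n for every n, consequently W commutes with the inverses, i.e. G^{n−1} ∘ W^n = W^n ∘ G^n for every n, and therefore the two contracting homotopies coincide: W^n ∘ G^n = G^{n−1} ∘ W^n for every n ∈ ℤ. -/
/-- If `f` intertwines `q` and `p`, then it intertwines a right inverse of `q` and a left inverse
of `p`. -/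
theorem LinearMap.comp_inverse_comm {R M N : Type*} [Semiring R]
    [AddCommMonoid M] [AddCommMonoid N] [Module R M] [Module R N]
    {f : M →ₗ[R] N} {p g : N →ₗ[R] N} {q h : M →ₗ[R] M}
    (hgp : g.comp p = LinearMap.id) (hqh : q.comp h = LinearMap.id)
    (hf : p.comp f = f.comp q) : g.comp f = f.comp h := by
  calc g.comp f = g.comp ((f.comp q).comp h) := by
        rw [LinearMap.comp_assoc, hqh, LinearMap.comp_id]
    _ = (g.comp p).comp (f.comp h) := by
        rw [← hf, LinearMap.comp_assoc, LinearMap.comp_assoc]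
    _ = f.comp h := by rw [hgp, LinearMap.id_comp]


/-- Setup as in Statement 0 (components written at shifted degree: `W n` is the
component `W^{n+1} : V^{n+1} → V^n` and `G n` the two-sided inverse `G^{n+1}` of
`P^{n+1} = (d n).comp (W n) + (W (n+1)).comp (d (n+1))`).  Assume in addition condition (i)
of a formally self-adjoint Green's witness: `d^{n-2} ∘ W^{n-1} ∘ W^n = W^n ∘ W^{n+1} ∘ d^n`,
written at degree `n+2` as
`(d n).comp ((W n).comp (W (n+1))) = (W (n+1)).comp ((W (n+1+1)).comp (d (n+1+1)))`.
Then `W` commutes with `P` (`P^{n-1} ∘ W^n = W^n ∘ P^n`), consequently `W` commutes with the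
inverses (`G^{n-1} ∘ W^n = W^n ∘ G^n`), and therefore the two contracting homotopies coincide
(`W^n ∘ G^n = G^{n-1} ∘ W^n`); each written at degree `n+2` below. -/
theorem stmt5 {K : Type*} [Field K] (V : ℤ → Type*)
    [∀ n, AddCommGroup (V n)] [∀ n, Module K (V n)]
    (d : ∀ n : ℤ, V n →ₗ[K] V (n + 1))
    (hd : ∀ (n : ℤ) (x : V n), d (n + 1) (d n x) = 0)
    (W : ∀ n : ℤ, V (n + 1) →ₗ[K] V n)
    (G : ∀ n : ℤ, V (n + 1) →ₗ[K] V (n + 1))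
    (hGP : ∀ n : ℤ,
      (G n).comp ((d n).comp (W n) + (W (n + 1)).comp (d (n + 1))) = LinearMap.id)
    (hPG : ∀ n : ℤ,
      ((d n).comp (W n) + (W (n + 1)).comp (d (n + 1))).comp (G n) = LinearMap.id)
    (hW : ∀ n : ℤ,
      (d n).comp ((W n).comp (W (n + 1)))
        = (W (n + 1)).comp ((W (n + 1 + 1)).comp (d (n + 1 + 1)))) :
    (∀ n : ℤ,
      ((d n).comp (W n) + (W (n + 1)).comp (d (n + 1))).comp (W (n + 1))
        = (W (n + 1)).comp
            ((d (n + 1)).comp (W (n + 1)) + (W (n + 1 + 1)).comp (d (n + 1 + 1))))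
    ∧ (∀ n : ℤ, (G n).comp (W (n + 1)) = (W (n + 1)).comp (G (n + 1)))
    ∧ (∀ n : ℤ, (W (n + 1)).comp (G (n + 1)) = (G n).comp (W (n + 1))) := by
  have hcomm : ∀ n : ℤ,
      ((d n).comp (W n) + (W (n + 1)).comp (d (n + 1))).comp (W (n + 1))
        = (W (n + 1)).comp
            ((d (n + 1)).comp (W (n + 1)) + (W (n + 1 + 1)).comp (d (n + 1 + 1))) := by
    intro n
    rw [LinearMap.add_comp, LinearMap.comp_add, LinearMap.comp_assoc, hW n,
      LinearMap.comp_assoc]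
    exact add_comm _ _
  have hinv : ∀ n : ℤ, (G n).comp (W (n + 1)) = (W (n + 1)).comp (G (n + 1)) :=
    fun n => LinearMap.comp_inverse_comm (hGP n) (hPG (n + 1)) (hcomm n)
  exact ⟨hcomm, hinv, fun n => (hinv n).symm⟩
end

section
/- Let W ∈ hom(𝒱, 𝒱)^{−1} be a degree −1 element of the enriched hom, i.e. a natural family of degree −1 maps W_c. Suppose that every component of P := ∂W is bijective, i.e. (P_c)^n = d ∘ (W_c)^n + (W_c)^{n+1} ∘ d : 𝒱(c)^n → 𝒱(c)^n is bijective for every object c of C and every n ∈ ℤ. Then the family Λ = (Λ_c)_{c∈C} with (Λ_c)^n := (W_c)^n ∘ ((P_c)^n)^{−1} is natural, i.e. Λ ∈ hom(𝒱, 𝒱)^{−1}, and satisfies ∂Λ = id, where id ∈ hom(𝒱, 𝒱)^0 is the identity natural transformation of 𝒱. -/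
open CategoryTheory

/-- A functor `𝒱 : C → Ch_K` from a small category `C` to the category of cochain complexes
of `K`-vector spaces, given by its data: for each object `c` a ℤ-graded vector space
`obj c` with differential `d c`, and for each morphism `γ` degreewise linear maps
`map γ` that are functorial and commute with the differentials. -/
structure ChF (K : Type) [Field K] (C : Type) [SmallCategory C] where
  obj : C → ℤ → Type
  [acg : ∀ c n, AddCommGroup (obj c n)]
  [mod : ∀ c n, Module K (obj c n)]
  d : ∀ (c : C) (n : ℤ), obj c n →ₗ[K] obj c (n + 1)
  dd : ∀ (c : C) (n : ℤ) (x : obj c n), d c (n + 1) (d c n x) = 0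
  map : ∀ {c₀ c₁ : C}, (c₀ ⟶ c₁) → ∀ (n : ℤ), obj c₀ n →ₗ[K] obj c₁ n
  map_id : ∀ (c : C) (n : ℤ), map (𝟙 c) n = LinearMap.id
  map_comp : ∀ {c₀ c₁ c₂ : C} (γ : c₀ ⟶ c₁) (γ' : c₁ ⟶ c₂) (n : ℤ),
      map (γ ≫ γ') n = (map γ' n).comp (map γ n)
  map_d : ∀ {c₀ c₁ : C} (γ : c₀ ⟶ c₁) (n : ℤ),
      (map γ (n + 1)).comp (d c₀ n) = (d c₁ n).comp (map γ n)

attribute [instance] ChF.acg ChF.mod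

variable {K : Type} [Field K] {C : Type} [SmallCategory C]

/-- Transport of components of `𝒱` along equalities of objects and of degrees. -/
def ChF.cst (𝒱 : ChF K C) {c c' : C} {m m' : ℤ} (hc : c = c') (hm : m = m') :
    𝒱.obj c m →ₗ[K] 𝒱.obj c' m' := by subst hc; subst hm; exact LinearMap.id


/-- A linear map intertwining two endomorphisms intertwines their inverses. -/
theorem LinearMap.comp_inverse_eq_of_comp_eq {R M N : Type*} [Semiring R] [AddCommMonoid M]
    [Module R M] [AddCommMonoid N] [Module R N] {f : M →ₗ[R] N} {P G : M →ₗ[R] M}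
    {Q H : N →ₗ[R] N} (hPG : P.comp G = LinearMap.id) (hHQ : H.comp Q = LinearMap.id)
    (h : f.comp P = Q.comp f) : f.comp G = H.comp f := by
  calc f.comp G = (H.comp Q).comp (f.comp G) := by rw [hHQ, LinearMap.id_comp]
    _ = H.comp ((Q.comp f).comp G) := by simp only [LinearMap.comp_assoc]
    _ = H.comp (f.comp (P.comp G)) := by rw [← h, LinearMap.comp_assoc]
    _ = H.comp f := by rw [hPG, LinearMap.comp_id]

/-- Let `𝒱 : C → Ch_K` be a functor and let `W ∈ hom(𝒱, 𝒱)^{−1}` be a natural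
family of degree `−1` maps (the component of `W_c` mapping degree `p+1` to degree `p` is
written `W c p`).  Suppose that every component of `P := ∂W`, i.e.
`(P_c)^{p+1} = d ∘ (W_c)^{p+1} + (W_c)^{p+2} ∘ d = (𝒱.d c p).comp (W c p) + (W c (p+1)).comp (𝒱.d c (p+1))`,
is bijective, with (necessarily unique two-sided) inverse `G c p`.  Then the family
`Λ = W ∘ G` (with components `(W c p).comp (G c p)`) is natural, i.e. `Λ ∈ hom(𝒱, 𝒱)^{−1}`,
and satisfies `∂Λ = id`.  (Degrees are written shifted by one: as `p` ranges over `ℤ`, the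
degree `p+1` covers all of `ℤ`.) -/
theorem stmt7 {K : Type} [Field K] {C : Type} [SmallCategory C] (𝒱 : ChF K C)
    (W : ∀ (c : C) (p : ℤ), 𝒱.obj c (p + 1) →ₗ[K] 𝒱.obj c p)
    (hWnat : ∀ (c₀ c₁ : C) (γ : c₀ ⟶ c₁) (p : ℤ),
      (𝒱.map γ p).comp (W c₀ p) = (W c₁ p).comp (𝒱.map γ (p + 1)))
    (hbij : ∀ (c : C) (p : ℤ),
      Function.Bijective
        ((𝒱.d c p).comp (W c p) + (W c (p + 1)).comp (𝒱.d c (p + 1))))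
    (G : ∀ (c : C) (p : ℤ), 𝒱.obj c (p + 1) →ₗ[K] 𝒱.obj c (p + 1))
    (hGP : ∀ (c : C) (p : ℤ),
      (G c p).comp ((𝒱.d c p).comp (W c p) + (W c (p + 1)).comp (𝒱.d c (p + 1)))
        = LinearMap.id)
    (hPG : ∀ (c : C) (p : ℤ),
      ((𝒱.d c p).comp (W c p) + (W c (p + 1)).comp (𝒱.d c (p + 1))).comp (G c p)
        = LinearMap.id) :
    (∀ (c₀ c₁ : C) (γ : c₀ ⟶ c₁) (p : ℤ),
      (𝒱.map γ p).comp ((W c₀ p).comp (G c₀ p))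
        = ((W c₁ p).comp (G c₁ p)).comp (𝒱.map γ (p + 1)))
    ∧ (∀ (c : C) (p : ℤ),
      (𝒱.d c p).comp ((W c p).comp (G c p))
        + (W c (p + 1)).comp ((G c (p + 1)).comp (𝒱.d c (p + 1)))
        = LinearMap.id) := by
  have hW : ∀ (c₀ c₁ : C) (γ : c₀ ⟶ c₁) (p : ℤ) (x : 𝒱.obj c₀ (p + 1)),
      𝒱.map γ p (W c₀ p x) = W c₁ p (𝒱.map γ (p + 1) x) :=
    fun c₀ c₁ γ p x => LinearMap.congr_fun (hWnat c₀ c₁ γ p) x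
  have hd : ∀ (c₀ c₁ : C) (γ : c₀ ⟶ c₁) (p : ℤ) (x : 𝒱.obj c₀ p),
      𝒱.map γ (p + 1) (𝒱.d c₀ p x) = 𝒱.d c₁ p (𝒱.map γ p x) :=
    fun c₀ c₁ γ p x => LinearMap.congr_fun (𝒱.map_d γ p) x
  constructor
  · intro c₀ c₁ γ p
    have hG : (𝒱.map γ (p + 1)).comp (G c₀ p) = (G c₁ p).comp (𝒱.map γ (p + 1)) := by
      refine LinearMap.comp_inverse_eq_of_comp_eq (hPG c₀ p) (hGP c₁ p) ?_
      ext x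
      simp [hW, hd]
    rw [← LinearMap.comp_assoc, hWnat, LinearMap.comp_assoc, hG, LinearMap.comp_assoc]
  · intro c p
    have hG : (𝒱.d c (p + 1)).comp (G c p) = (G c (p + 1)).comp (𝒱.d c (p + 1)) := by
      refine LinearMap.comp_inverse_eq_of_comp_eq (hPG c p) (hGP c (p + 1)) ?_
      ext x
      simp [𝒱.dd]
    rw [← hG, ← LinearMap.comp_assoc, ← LinearMap.comp_assoc, ← LinearMap.add_comp, hPG]
end
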